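/- Let p, r be integers with p > 10^8, r > 10p, and 40 dividing p+r. Let f: H_p -> H_p and g: H_{r+p} -> H_{r+p} be K-linear maps such that g(ww') = w·f(w') for all monomials w in M_r and w' in M_p. Let z = uv with z in M_{p+r}, u in M_r, v in M_p. Suppose that for all n1,...,n6 with n1+...+n6 = p+r one has g(z(n1,...,n6)) ∈ Σ_{r1+...+r6 = r} u(r1,...,r6)·f(S(v)) + c + Σ_{i=1}^{s} K·h_i, where s ≤ 10^{-4}(r+p)^2, the h_i are elements of H_{p+r}, and c ∈ Σ_{w ∈ W} w·A for some set W of monomials of degree r such that W together with the elements u(r1,...,r6) (r1+...+r6 = r) is K-linearly independent. Then f(v(p1,...,p6)) lies in f(S(v)) for all p1,...,p6 with p1+...+p6 = p. -/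

import Mathlib

open scoped Classical BigOperators

noncomputable section

/-- The free associative unital `K`-algebra on six generators `x1 x2 x3 y1 y2 y3`,
realized as the monoid algebra of the free monoid on six letters. -/
abbrev FreeA (K : Type) [Field K] : Type := MonoidAlgebra K (FreeMonoid (Fin 6))

/-- The map sending the generators `x1 x2 x3` to `x` and `y1 y2 y3` to `y`. -/
def bf : Fin 6 → Fin 2 := fun i => if (i : ℕ) < 3 then 0 else 1

/-- The monoid homomorphism `β` from monomials in six letters to monomials in two letters. -/
def bm : FreeMonoid (Fin 6) →* FreeMonoid (Fin 2) := FreeMonoid.map bf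

/-- Degree (length) of a monomial. -/
def len {α : Type} (w : FreeMonoid α) : ℕ := (FreeMonoid.toList w).length

/-- The ordering `≺` on monomials in `x, y`: same degree and lexicographically smaller. -/
def prec (z z' : FreeMonoid (Fin 2)) : Prop :=
  len z = len z' ∧ List.Lex (· < ·) (FreeMonoid.toList z) (FreeMonoid.toList z')

/-- The finite set of monomials of degree `n` in six letters. -/
def wordsOf (n : ℕ) : Finset (FreeMonoid (Fin 6)) :=
  (Finset.univ : Finset (Fin n → Fin 6)).image fun f => FreeMonoid.ofList (List.ofFn f)

/-- `wComp K z n` is `z(n₁,…,n₆)`: the sum of all monomials `v` (in six letters) with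
`β v = z` and with exactly `nᵢ` occurrences of the `i`-th generator; it is `0` if no such
monomial exists (in particular if some `nᵢ` is negative). -/
def wComp (K : Type) [Field K] (z : FreeMonoid (Fin 2)) (n : Fin 6 → ℤ) : FreeA K :=
  ∑ v ∈ (wordsOf (len z)).filter
      (fun v => bm v = z ∧ ∀ e : Fin 6, ((FreeMonoid.toList v).count e : ℤ) = n e),
    MonoidAlgebra.single v 1

/-- `H_i`: the `K`-span of the monomials of degree `i`. -/
def Hgr (K : Type) [Field K] (i : ℕ) : Submodule K (FreeA K) :=
  Submodule.span K {a | ∃ w : FreeMonoid (Fin 6), len w = i ∧ a = MonoidAlgebra.single w (1 : K)}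

/-- `S(z)` for `z` a monomial in `x, y`: the span of the monomials `w` in six letters of the
same degree with `β w ≺ z`.  (For a monomial `z` in six letters, `S(z) = SP K (bm z)`.) -/
def SP (K : Type) [Field K] (z : FreeMonoid (Fin 2)) : Submodule K (FreeA K) :=
  Submodule.span K
    {a | ∃ w : FreeMonoid (Fin 6), len w = len z ∧ prec (bm w) z ∧
      a = MonoidAlgebra.single w (1 : K)}

/-- `Q(z)`: the span of the monomials `w` of the same degree with `β w = z`. -/
def QP (K : Type) [Field K] (z : FreeMonoid (Fin 2)) : Submodule K (FreeA K) :=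
  Submodule.span K
    {a | ∃ w : FreeMonoid (Fin 6), len w = len z ∧ bm w = z ∧
      a = MonoidAlgebra.single w (1 : K)}

end
noncomputable section Content

/-- The number of occurrences of each generator in a monomial. -/
def content (w : FreeMonoid (Fin 6)) : Fin 6 →₀ ℕ :=
  Multiset.toFinsupp (w.toList : Multiset (Fin 6))

lemma content_apply (w : FreeMonoid (Fin 6)) (e : Fin 6) : content w e = w.toList.count e := by
  simp [content]

lemma content_mul (w w' : FreeMonoid (Fin 6)) : content (w * w') = content w + content w' := by
  ext e
  simp [content_apply]

lemma sum_content (w : FreeMonoid (Fin 6)) : ∑ e, content w e = len w := by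
  simp only [content_apply, len]
  have h := Multiset.sum_count_eq_card (s := (Finset.univ : Finset (Fin 6)))
    (m := (w.toList : Multiset (Fin 6))) (by simp)
  simpa using h

lemma len_mul {α : Type} (w w' : FreeMonoid α) : len (w * w') = len w + len w' := by
  simp [len]

lemma len_bm (w : FreeMonoid (Fin 6)) : len (bm w) = len w := by
  simp [len, bm, FreeMonoid.toList_map]

lemma mem_wordsOf {n : ℕ} {w : FreeMonoid (Fin 6)} : w ∈ wordsOf n ↔ len w = n := by
  simp only [wordsOf, Finset.mem_image, Finset.mem_univ, true_and]
  constructor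
  · rintro ⟨F, rfl⟩
    simp [len]
  · rintro rfl
    exact ⟨w.toList.get, congrArg FreeMonoid.ofList (List.ofFn_get _)⟩

/-- The finite set of monomials in six letters lying over `z`. -/
def fiber (z : FreeMonoid (Fin 2)) : Finset (FreeMonoid (Fin 6)) :=
  (wordsOf (len z)).filter fun w => bm w = z

lemma mem_fiber {z : FreeMonoid (Fin 2)} {w : FreeMonoid (Fin 6)} : w ∈ fiber z ↔ bm w = z := by
  simp only [fiber, Finset.mem_filter, mem_wordsOf, and_iff_right_iff_imp]
  rintro rfl
  exact (len_bm w).symm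

lemma len_of_mem_fiber {z : FreeMonoid (Fin 2)} {w : FreeMonoid (Fin 6)} (h : w ∈ fiber z) :
    len w = len z := by
  rw [← mem_fiber.1 h, len_bm]

lemma bm_take_drop {z₁ z₂ : FreeMonoid (Fin 2)} {w : FreeMonoid (Fin 6)} (h : bm w = z₁ * z₂) :
    bm (FreeMonoid.ofList (w.toList.take (len z₁))) = z₁ ∧
      bm (FreeMonoid.ofList (w.toList.drop (len z₁))) = z₂ := by
  have h' : w.toList.map bf = z₁.toList ++ z₂.toList := congrArg FreeMonoid.toList h
  constructor
  · change FreeMonoid.ofList ((w.toList.take (len z₁)).map bf) = z₁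
    rw [List.map_take, h', len, List.take_left]
    rfl
  · change FreeMonoid.ofList ((w.toList.drop (len z₁)).map bf) = z₂
    rw [List.map_drop, h', len, List.drop_left]
    rfl

/-- A word over `z` with prescribed content exists as soon as the content is compatible
with the degrees of `z`. -/
lemma exists_word (z : List (Fin 2)) (n : Fin 6 → ℕ)
    (h : ∀ c, ∑ e with bf e = c, n e = z.count c) :
    ∃ w : List (Fin 6), w.map bf = z ∧ ∀ e, w.count e = n e := by
  induction z generalizing n with
  | nil =>
    refine ⟨[], rfl, fun e => ?_⟩
    have := h (bf e)
    simp only [List.count_nil, Finset.sum_eq_zero_iff, Finset.mem_filter, Finset.mem_univ,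
      true_and] at this
    simpa using (this e rfl).symm
  | cons c z ih =>
    obtain ⟨e, he, hne⟩ : ∃ e, bf e = c ∧ n e ≠ 0 := by
      by_contra! hcon
      have := h c
      rw [Finset.sum_eq_zero (fun e he => hcon e (Finset.mem_filter.1 he).2)] at this
      simp at this
    obtain ⟨m, rfl⟩ : ∃ m : Fin 6 → ℕ, n = m + Pi.single e 1 :=
      ⟨n - Pi.single e 1, by
        funext i
        by_cases hi : i = e
        · subst hi; simp; omega
        · simp [hi]⟩
    obtain ⟨w, hw, hc⟩ := ih m fun d => by
      have := h d
      simp only [Pi.add_apply, Finset.sum_add_distrib, List.count_cons] at this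
      by_cases hd : d = c
      · subst hd
        simpa [Pi.single_apply, he] using this
      · simpa [Pi.single_apply, he, hd, Ne.symm hd] using this
    refine ⟨e :: w, by simp [hw, he], fun i => ?_⟩
    by_cases hi : i = e
    · subst hi; simp [hc]
    · simp [hc, hi, Ne.symm hi]

/-- Swapping two distinct letters of the same class yields a second word with the same content
over the same monomial. -/
lemma exists_ne_word (w : List (Fin 6)) (e e' : Fin 6) (hne : e ≠ e') (hb : bf e = bf e')
    (he : e ∈ w) (he' : e' ∈ w) :
    ∃ w' : List (Fin 6), w' ≠ w ∧ w'.map bf = w.map bf ∧ ∀ i, w'.count i = w.count i := by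
  obtain ⟨a, ha⟩ := List.get_of_mem he
  obtain ⟨b, hb'⟩ := List.get_of_mem he'
  refine ⟨List.ofFn (w.get ∘ Equiv.swap a b), fun h => ?_, ?_, fun i => ?_⟩
  · have h2 : List.ofFn (w.get ∘ Equiv.swap a b) = List.ofFn w.get := by rw [h, List.ofFn_get]
    have := congrFun (List.ofFn_injective h2) a
    simp only [Function.comp_apply, Equiv.swap_apply_left, ha, hb'] at this
    exact hne this.symm
  · conv_rhs => rw [← List.ofFn_get w]
    rw [List.map_ofFn, List.map_ofFn]
    congr 1
    funext i
    simp only [Function.comp_apply]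
    rcases eq_or_ne i a with rfl | hia
    · rw [Equiv.swap_apply_left, ha, hb', hb]
    rcases eq_or_ne i b with rfl | hib
    · rw [Equiv.swap_apply_right, ha, hb', hb]
    · rw [Equiv.swap_apply_of_ne_of_ne hia hib]
  · have := ((Equiv.swap a b).ofFn_comp_perm w.get).count_eq i
    rwa [List.ofFn_get] at this

end Content

noncomputable section Components

variable {K : Type} [Field K]

lemma wComp_natCast (z : FreeMonoid (Fin 2)) (n : Fin 6 →₀ ℕ) :
    wComp K z (fun i => (n i : ℤ)) =
      ∑ w ∈ (fiber z).filter (fun w => content w = n), MonoidAlgebra.single w 1 := by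
  rw [wComp, fiber, Finset.filter_filter]
  refine Finset.sum_congr (Finset.filter_congr fun w _ => ?_) fun _ _ => rfl
  simp [Finsupp.ext_iff, content_apply]

lemma wComp_eq_zero_of_neg (z : FreeMonoid (Fin 2)) (n : Fin 6 → ℤ) (e : Fin 6) (he : n e < 0) :
    wComp K z n = 0 := by
  rw [wComp, Finset.filter_false_of_mem, Finset.sum_empty]
  rintro w - ⟨-, h⟩
  have := h e
  omega

lemma coeff_wComp (z : FreeMonoid (Fin 2)) (n : Fin 6 →₀ ℕ) (w : FreeMonoid (Fin 6)) :
    (wComp K z (fun i => (n i : ℤ))).coeff w = if bm w = z ∧ content w = n then 1 else 0 := by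
  rw [wComp_natCast]
  simp [MonoidAlgebra.coeff_sum, Finsupp.finsetSum_apply, Finsupp.single_apply, mem_fiber]

/-- The generating polynomial of a family of scalars indexed by the words over `z`. -/
def genPoly (z : FreeMonoid (Fin 2)) (θ : FreeMonoid (Fin 6) → K) : MvPolynomial (Fin 6) K :=
  ∑ w ∈ fiber z, MvPolynomial.monomial (content w) (θ w)

lemma coeff_genPoly (z : FreeMonoid (Fin 2)) (L : FreeA K →ₗ[K] K) (n : Fin 6 →₀ ℕ) :
    (genPoly z fun w => L (MonoidAlgebra.single w 1)).coeff n =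
      L (wComp K z fun i => (n i : ℤ)) := by
  rw [genPoly, MvPolynomial.coeff_sum, wComp_natCast, map_sum, Finset.sum_filter]
  simp [MvPolynomial.coeff_monomial]

lemma genPoly_mul (z₁ z₂ : FreeMonoid (Fin 2)) (θ θ₁ θ₂ : FreeMonoid (Fin 6) → K)
    (h : ∀ w₁ w₂, len w₁ = len z₁ → len w₂ = len z₂ → θ (w₁ * w₂) = θ₁ w₁ * θ₂ w₂) :
    genPoly (z₁ * z₂) θ = genPoly z₁ θ₁ * genPoly z₂ θ₂ := by
  rw [genPoly, genPoly, genPoly, Finset.sum_mul_sum, ← Finset.sum_product']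
  symm
  refine Finset.sum_bij' (fun q _ => q.1 * q.2)
    (fun w _ => (FreeMonoid.ofList (w.toList.take (len z₁)),
      FreeMonoid.ofList (w.toList.drop (len z₁)))) ?_ ?_ ?_ ?_ ?_
  · rintro ⟨w₁, w₂⟩ hq
    obtain ⟨h₁, h₂⟩ := Finset.mem_product.1 hq
    rw [mem_fiber] at *
    rw [map_mul, h₁, h₂]
  · intro w hw
    have := bm_take_drop (mem_fiber.1 hw)
    exact Finset.mem_product.2 ⟨mem_fiber.2 this.1, mem_fiber.2 this.2⟩
  · rintro ⟨w₁, w₂⟩ hq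
    obtain ⟨h₁, -⟩ := Finset.mem_product.1 hq
    rw [← len_of_mem_fiber h₁]
    simp [len]
  · intro w _
    exact List.take_append_drop _ w.toList
  · rintro ⟨w₁, w₂⟩ hq
    obtain ⟨h₁, h₂⟩ := Finset.mem_product.1 hq
    rw [MvPolynomial.monomial_mul, ← content_mul,
      h _ _ (len_of_mem_fiber h₁) (len_of_mem_fiber h₂)]

/-- Applying a functional to the part of each monomial behind its first `r` letters. -/
def contract (r : ℕ) (φ : FreeA K →ₗ[K] K) : FreeA K →ₗ[K] FreeA K :=
  (Finsupp.linearCombination K fun w : FreeMonoid (Fin 6) =>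
    φ (MonoidAlgebra.single (FreeMonoid.ofList (w.toList.drop r)) 1) •
      (MonoidAlgebra.single (FreeMonoid.ofList (w.toList.take r)) 1 : FreeA K)) ∘ₗ
  (MonoidAlgebra.coeffLinearEquiv K).toLinearMap

lemma contract_single_mul {r : ℕ} (φ : FreeA K →ₗ[K] K) {w : FreeMonoid (Fin 6)} (hw : len w = r)
    (b : FreeA K) :
    contract r φ (MonoidAlgebra.single w 1 * b) = φ b • MonoidAlgebra.single w 1 := by
  suffices h : contract r φ ∘ₗ LinearMap.mulLeft K (MonoidAlgebra.single w 1) =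
      φ.smulRight (MonoidAlgebra.single w 1) from LinearMap.congr_fun h b
  refine MonoidAlgebra.lhom_ext' fun w' => LinearMap.ext_ring ?_
  subst hw
  simp [contract, len, MonoidAlgebra.single_mul_single]

lemma contract_wComp_mul (φ : FreeA K →ₗ[K] K) (z : FreeMonoid (Fin 2)) (n : Fin 6 → ℤ)
    (b : FreeA K) : contract (len z) φ (wComp K z n * b) = φ b • wComp K z n := by
  rw [wComp, Finset.sum_mul, map_sum, Finset.smul_sum]
  refine Finset.sum_congr rfl fun w hw => contract_single_mul φ ?_ b
  exact mem_wordsOf.1 (Finset.mem_filter.1 hw).1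

/-- If both of two distinct letters of the same class occur in `n`, then the component `z(n)`,
when compatible with the degrees of `z`, is neither zero nor a monomial. -/
lemma wComp_ne_zero_and_ne_single (z : FreeMonoid (Fin 2)) (n : Fin 6 →₀ ℕ)
    (hn : ∀ c, ∑ e with bf e = c, n e = z.toList.count c) (e e' : Fin 6) (hne : e ≠ e')
    (hb : bf e = bf e') (he : n e ≠ 0) (he' : n e' ≠ 0) :
    wComp K z (fun i => (n i : ℤ)) ≠ 0 ∧
      ∀ w, MonoidAlgebra.single w 1 ≠ wComp K z (fun i => (n i : ℤ)) := by
  obtain ⟨w₁, hw₁, hc₁⟩ := exists_word z.toList n hn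
  obtain ⟨w₂, hw₂, hb₂, hc₂⟩ := exists_ne_word w₁ e e' hne hb
    (List.count_pos_iff.1 (by rw [hc₁]; omega)) (List.count_pos_iff.1 (by rw [hc₁]; omega))
  have h₁ : (wComp K z (fun i => (n i : ℤ))).coeff (FreeMonoid.ofList w₁) = 1 := by
    rw [coeff_wComp, if_pos]
    exact ⟨hw₁, Finsupp.ext fun i => by rw [content_apply]; exact hc₁ i⟩
  have h₂ : (wComp K z (fun i => (n i : ℤ))).coeff (FreeMonoid.ofList w₂) = 1 := by
    rw [coeff_wComp, if_pos]
    exact ⟨hb₂.trans hw₁, Finsupp.ext fun i => by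
      rw [content_apply]; exact (hc₂ i).trans (hc₁ i)⟩
  refine ⟨fun h => by simp [h] at h₁, fun w hw => hw₂ ?_⟩
  rw [← hw, MonoidAlgebra.coeff_single] at h₁ h₂
  have e₁ : w = FreeMonoid.ofList w₁ := by
    by_contra hcon
    rw [Finsupp.single_apply, if_neg hcon] at h₁
    exact zero_ne_one h₁
  have e₂ : w = FreeMonoid.ofList w₂ := by
    by_contra hcon
    rw [Finsupp.single_apply, if_neg hcon] at h₂
    exact zero_ne_one h₂
  exact FreeMonoid.ofList.injective (e₂.symm.trans e₁)

/-- Quadratically many components `z(n)` are neither zero nor monomials. -/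
lemma exists_components (z : FreeMonoid (Fin 2)) (m : ℕ) (hm : 4 * m ≤ len z) :
    ∃ ρ : Fin m × Fin m → (Fin 6 →₀ ℕ), Function.Injective ρ ∧
      ∀ q, ∑ i, ρ q i = len z ∧ wComp K z (fun i => (ρ q i : ℤ)) ≠ 0 ∧
        ∀ w, MonoidAlgebra.single w 1 ≠ wComp K z (fun i => (ρ q i : ℤ)) := by
  have hcount : z.toList.count 0 + z.toList.count 1 = len z := by
    have h := Multiset.sum_count_eq_card (s := (Finset.univ : Finset (Fin 2)))
      (m := (z.toList : Multiset (Fin 2))) (by simp)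
    simpa [len] using h
  have hsplit (n : Fin 6 → ℕ) (h₀ : n 0 + n 1 + n 2 = z.toList.count 0)
      (h₁ : n 3 + n 4 + n 5 = z.toList.count 1) (c : Fin 2) :
      ∑ e with bf e = c, n e = z.toList.count c := by
    rw [Finset.sum_filter]
    fin_cases c <;> simp [Fin.sum_univ_six, bf] <;> omega
  rcases le_total (z.toList.count 1) (z.toList.count 0) with hle | hle
  · refine ⟨fun q => Finsupp.equivFunOnFinite.symm
      ![q.1 + 1, q.2 + 1, z.toList.count 0 - 2 - q.1 - q.2, z.toList.count 1, 0, 0], ?_, ?_⟩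
    · rintro ⟨i, j⟩ ⟨i', j'⟩ h
      have h' := Finsupp.equivFunOnFinite.symm.injective h
      have h₀ := congrFun h' 0
      have h₁ := congrFun h' 1
      simp at h₀ h₁
      ext <;> simp <;> omega
    · rintro ⟨i, j⟩
      refine ⟨?_, wComp_ne_zero_and_ne_single z _ (hsplit _ ?_ ?_) 0 1 (by decide) (by simp [bf])
        ?_ ?_⟩
      · simp [Fin.sum_univ_six]; omega
      all_goals simp
      omega
  · refine ⟨fun q => Finsupp.equivFunOnFinite.symm
      ![z.toList.count 0, 0, 0, q.1 + 1, q.2 + 1, z.toList.count 1 - 2 - q.1 - q.2], ?_, ?_⟩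
    · rintro ⟨i, j⟩ ⟨i', j'⟩ h
      have h' := Finsupp.equivFunOnFinite.symm.injective h
      have h₀ := congrFun h' 3
      have h₁ := congrFun h' 4
      simp at h₀ h₁
      ext <;> simp <;> omega
    · rintro ⟨i, j⟩
      refine ⟨?_, wComp_ne_zero_and_ne_single z _ (hsplit _ ?_ ?_) 3 4 (by decide) (by simp [bf])
        ?_ ?_⟩
      · simp [Fin.sum_univ_six]; omega
      all_goals simp
      omega

end Components

/-- If a linearly independent set contains finitely many chosen vectors `x i`, more than `s` in
number, then for any `s` vectors there is a functional killing these and all the other members of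
the set, but not all the `x i`. -/
lemma exists_functional {K V ι : Type} [Field K] [AddCommGroup V] [Module K V] [Fintype ι]
    {X : Set V} (hX : LinearIndependent K (fun a : X => (a : V))) (x : ι → V)
    (hx : Function.Injective x) (hxX : ∀ i, x i ∈ X) {s : ℕ} (hs : s < Fintype.card ι)
    (y : Fin s → V) :
    ∃ ψ : V →ₗ[K] K, (∃ i, ψ (x i) ≠ 0) ∧ (∀ a ∈ X, (∀ i, a ≠ x i) → ψ a = 0) ∧
      ∀ j, ψ (y j) = 0 := by
  have hX' : LinearIndepOn K id X := hX
  let B := Module.Basis.extend hX'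
  have hsub : X ⊆ hX'.extend (Set.subset_univ X) := hX'.subset_extend _
  have hB (a b : V) (ha : a ∈ X) (hb : b ∈ X) :
      B.coord ⟨a, hsub ha⟩ b = if a = b then 1 else 0 := by
    have : b = B ⟨b, hsub hb⟩ :=
      (Module.Basis.extend_apply_self hX' ⟨b, hsub hb⟩).symm
    conv_lhs => rw [this]
    simp [Module.Basis.coord_apply, Finsupp.single_apply, eq_comm]
  let Ψ : (ι → K) →ₗ[K] (V →ₗ[K] K) :=
    Fintype.linearCombination K fun i => B.coord ⟨x i, hsub (hxX i)⟩
  let T : (ι → K) →ₗ[K] (Fin s → K) :=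
    LinearMap.pi fun j => LinearMap.applyₗ (y j) ∘ₗ Ψ
  have hker : LinearMap.ker T ≠ ⊥ := LinearMap.ker_ne_bot_of_finrank_lt (by simpa using hs)
  obtain ⟨α, hα, hα0⟩ := Submodule.exists_mem_ne_zero_of_ne_bot hker
  have hΨ (b : V) (hb : b ∈ X) : Ψ α b = ∑ i, α i * if x i = b then 1 else 0 := by
    simp [Ψ, Fintype.linearCombination_apply, LinearMap.sum_apply, -Module.Basis.coord_apply,
      hB _ _ (hxX _) hb]
  obtain ⟨i, hi⟩ := Function.ne_iff.1 hα0
  refine ⟨Ψ α, ⟨i, ?_⟩, fun a ha hne => ?_, fun j => congrFun (LinearMap.mem_ker.1 hα) j⟩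
  · rw [hΨ _ (hxX i)]
    simpa [hx.eq_iff] using hi
  · rw [hΨ _ ha]
    exact Finset.sum_eq_zero fun i _ => by rw [if_neg (hne i).symm, mul_zero]

theorem stmt7 (K : Type) [Field K] (p r : ℕ) (hp : 10 ^ 8 < p) (hr : 10 * p < r)
    (hdvd : 40 ∣ (p + r))
    (f g : FreeA K →ₗ[K] FreeA K)
    (hf : ∀ a ∈ Hgr K p, f a ∈ Hgr K p)
    (hg : ∀ a ∈ Hgr K (r + p), g a ∈ Hgr K (r + p))
    (hmul : ∀ w w' : FreeMonoid (Fin 6), len w = r → len w' = p →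
      g (MonoidAlgebra.single (w * w') 1) =
        MonoidAlgebra.single w 1 * f (MonoidAlgebra.single w' 1))
    (u v : FreeMonoid (Fin 6)) (hu : len u = r) (hv : len v = p)
    (s : ℕ) (hs : 10 ^ 4 * s ≤ (r + p) ^ 2)
    (hvec : Fin s → FreeA K) (hhi : ∀ i, hvec i ∈ Hgr K (p + r))
    (W : Set (FreeMonoid (Fin 6))) (hW : ∀ w ∈ W, len w = r)
    (hindep : LinearIndependent K
      (fun a : ↥((fun w => (MonoidAlgebra.single w 1 : FreeA K)) '' W ∪
          {x : FreeA K | x ≠ 0 ∧ ∃ rr : Fin 6 → ℕ, (∑ i, rr i) = r ∧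
            x = wComp K (bm u) (fun i => (rr i : ℤ))}) => (a : FreeA K)))
    (c : FreeA K)
    (hc : c ∈ Submodule.span K
      {x : FreeA K | ∃ w ∈ W, ∃ b : FreeA K, x = MonoidAlgebra.single w 1 * b})
    (hyp : ∀ n : Fin 6 → ℤ, (∑ i, n i) = ((p + r : ℕ) : ℤ) →
      g (wComp K (bm (u * v)) n) - c ∈
        Submodule.span K
          {x : FreeA K | ∃ rr : Fin 6 → ℕ, (∑ i, rr i) = r ∧
            ∃ t ∈ Submodule.map f (SP K (bm v)),
              x = wComp K (bm u) (fun i => (rr i : ℤ)) * t} ⊔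
        Submodule.span K (Set.range hvec)) :
    ∀ n : Fin 6 → ℤ, (∑ i, n i) = (p : ℤ) →
      f (wComp K (bm v) n) ∈ Submodule.map f (SP K (bm v)) := by
  by_contra! hcon
  obtain ⟨n₀, -, hn₀⟩ := hcon
  obtain ⟨φ, hφ0, hφker⟩ := Submodule.exists_le_ker_of_notMem hn₀
  have hzu : len (bm u) = r := by rw [len_bm, hu]
  have hzv : len (bm v) = p := by rw [len_bm, hv]
  obtain ⟨ρ, hρinj, hρ⟩ := exists_components (K := K) (bm u) (r / 4) (by omega)
  have hcard : s < Fintype.card (Fin (r / 4) × Fin (r / 4)) := by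
    simp only [Fintype.card_prod, Fintype.card_fin]
    have h₁ : r ≤ 5 * (r / 4) := by omega
    have h₂ : 10 * (r + p) ≤ 11 * r := by omega
    nlinarith
  have hxinj : Function.Injective fun q => wComp K (bm u) (fun i => (ρ q i : ℤ)) := by
    intro q q' h
    apply hρinj
    by_contra hne
    apply (hρ q).2.1
    ext w
    have := congrArg (fun a => MonoidAlgebra.coeff a w) h
    simp only [coeff_wComp] at this ⊢
    split_ifs at this ⊢ with h₁ h₂ <;> simp_all
  obtain ⟨ψ, ⟨q, hq⟩, hψX, hψh⟩ := exists_functional hindep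
    (fun q => wComp K (bm u) (fun i => (ρ q i : ℤ))) hxinj
    (fun q => Or.inr ⟨(hρ q).2.1, fun i => ρ q i, by rw [(hρ q).1, hzu], rfl⟩) hcard
    (fun j => contract r φ (hvec j))
  have hψW (w) (hw : w ∈ W) : ψ (MonoidAlgebra.single w 1) = 0 :=
    hψX _ (Or.inl ⟨w, hw, rfl⟩) fun q => (hρ q).2.2 w
  let Φ : FreeA K →ₗ[K] K := ψ ∘ₗ contract r φ
  have hΦc : Φ c = 0 := by
    suffices h : c ∈ LinearMap.ker Φ from h
    refine Submodule.span_le.2 ?_ hc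
    rintro _ ⟨w, hw, b, rfl⟩
    rw [SetLike.mem_coe, LinearMap.mem_ker, LinearMap.comp_apply, contract_single_mul φ (hW w hw),
      map_smul, hψW w hw, smul_zero]
  have hΦg (n : Fin 6 →₀ ℕ) : Φ (g (wComp K (bm (u * v)) fun i => (n i : ℤ))) = 0 := by
    by_cases hn : ∑ i, n i = p + r
    · have h := hyp (fun i => (n i : ℤ)) (by exact_mod_cast hn)
      rw [← sub_zero (Φ _)]
      nth_rw 1 [← hΦc]
      rw [← map_sub]
      refine (sup_le (Submodule.span_le.2 ?_) (Submodule.span_le.2 ?_) :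
        _ ≤ LinearMap.ker Φ) h
      · rintro _ ⟨rr, -, t, ht, rfl⟩
        have : φ t = 0 := hφker ht
        simp [Φ, ← hzu, contract_wComp_mul, this]
      · rintro _ ⟨j, rfl⟩
        exact hψh j
    · rw [wComp_natCast, Finset.filter_false_of_mem, Finset.sum_empty, map_zero, map_zero]
      rintro w hw rfl
      apply hn
      rw [sum_content, len_of_mem_fiber hw, len_bm, len_mul, hu, hv, add_comm]
  have hprod := genPoly_mul (bm u) (bm v) (fun w => (Φ ∘ₗ g) (MonoidAlgebra.single w 1))
    (fun w => ψ (MonoidAlgebra.single w 1)) (fun w => (φ ∘ₗ f) (MonoidAlgebra.single w 1))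
    (fun w₁ w₂ h₁ h₂ => by
      rw [hzu] at h₁
      rw [hzv] at h₂
      simp only [Φ, LinearMap.comp_apply, hmul w₁ w₂ h₁ h₂, contract_single_mul φ h₁, map_smul,
        smul_eq_mul, mul_comm])
  have hzero : genPoly (bm u * bm v) (fun w => (Φ ∘ₗ g) (MonoidAlgebra.single w 1)) = 0 := by
    ext n
    rw [coeff_genPoly, ← map_mul]
    exact hΦg n
  rw [hzero, eq_comm, mul_eq_zero] at hprod
  rcases hprod with h | h
  · apply hq
    rw [← coeff_genPoly, h, MvPolynomial.coeff_zero]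
  · by_cases hneg : ∃ e, n₀ e < 0
    · obtain ⟨e, he⟩ := hneg
      rw [wComp_eq_zero_of_neg _ _ e he, map_zero, map_zero] at hφ0
      exact hφ0 rfl
    · push Not at hneg
      obtain ⟨n, rfl⟩ : ∃ n : Fin 6 →₀ ℕ, n₀ = fun i => (n i : ℤ) :=
        ⟨Finsupp.equivFunOnFinite.symm fun i => (n₀ i).toNat, by
          funext i; simp [Int.toNat_of_nonneg (hneg i)]⟩
      apply hφ0
      have := coeff_genPoly (bm v) (φ ∘ₗ f) n
      rw [h, MvPolynomial.coeff_zero] at this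
      exact this.symm
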